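/- Let n > 1 be a positive odd integer. Then sum_{k=0}^{(n-1)/2} [4k+1] * (q^{-1};q^2)_k (q;q^2)_k^3 / ((q^4;q^2)_k (q^2;q^2)_k^3) * q^{2k} = [n]^3 * (q;q^2)_{(n-1)/2}^4 / ((q^4;q^2)_{(n-1)/2} (q^2;q^2)_{(n-1)/2}^3), and this rational function is congruent to 0 modulo [n]^3; that is, its numerator in reduced form is divisible by [n]^3 in Z[q]. -/

import Mathlib

open Finset Polynomial

/-- The `q`-shifted factorial `(a;q)_k`. -/
noncomputable def qp {F : Type*} [Field F] (a q : F) (k : ℕ) : F :=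
  ∏ j ∈ Finset.range k, (1 - a * q ^ j)

/-- The `q`-integer `[m]` as a rational function. -/
noncomputable def qint (m : ℕ) : RatFunc ℚ :=
  ∑ i ∈ Finset.range m, RatFunc.X ^ i

/-- The `q`-integer `[m]` as a polynomial. -/
noncomputable def qnat (m : ℕ) : Polynomial ℚ :=
  ∑ i ∈ Finset.range m, Polynomial.X ^ i

/-- The `q`-binomial coefficient as a rational function. -/
noncomputable def qbin (n k : ℕ) : RatFunc ℚ :=
  qp RatFunc.X RatFunc.X n / (qp RatFunc.X RatFunc.X k * qp RatFunc.X RatFunc.X (n - k))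

lemma qp_zero {F : Type*} [Field F] (a q : F) : qp a q 0 = 1 := by
  simp [qp]

lemma qp_succ {F : Type*} [Field F] (a q : F) (k : ℕ) :
    qp a q (k + 1) = qp a q k * (1 - a * q ^ k) := by
  simp [qp, prod_range_succ]

lemma qp_succ_left {F : Type*} [Field F] (a q : F) (k : ℕ) :
    qp a q (k + 1) = (1 - a) * qp (a * q) q k := by
  simp [qp, prod_range_succ', pow_succ', mul_assoc, mul_comm]

lemma RatFunc.one_sub_X_pow_ne_zero {m : ℕ} (hm : m ≠ 0) :
    (1 - RatFunc.X ^ m : RatFunc ℚ) ≠ 0 := by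
  intro h
  have h' : (RatFunc.X ^ m : RatFunc ℚ) = 1 := (sub_eq_zero.mp h).symm
  rw [← RatFunc.algebraMap_X, ← map_pow, ← map_one (algebraMap ℚ[X] (RatFunc ℚ))] at h'
  have h₂ := congrArg natDegree (RatFunc.algebraMap_injective ℚ h')
  simp at h₂
  exact hm h₂

lemma Polynomial.one_sub_X_pow_ne_zero {m : ℕ} (hm : m ≠ 0) : (1 - X ^ m : ℚ[X]) ≠ 0 := by
  intro h
  apply RatFunc.one_sub_X_pow_ne_zero hm
  simpa using congrArg (algebraMap ℚ[X] (RatFunc ℚ)) h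

lemma qint_mul_one_sub (m : ℕ) : qint m * (1 - RatFunc.X) = 1 - RatFunc.X ^ m :=
  geom_sum_mul_neg _ _

lemma qnat_mul_one_sub (m : ℕ) : qnat m * (1 - X) = 1 - X ^ m :=
  geom_sum_mul_neg _ _

lemma algebraMap_qnat (m : ℕ) : algebraMap ℚ[X] (RatFunc ℚ) (qnat m) = qint m := by
  simp [qnat, qint]

/-- A base-`q ^ 2` shifted factorial of a positive power of `q` comes from a polynomial. -/
lemma qp_X_pow (a k : ℕ) :
    qp (RatFunc.X ^ a : RatFunc ℚ) (RatFunc.X ^ 2) k =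
      algebraMap ℚ[X] (RatFunc ℚ) (∏ j ∈ range k, (1 - X ^ (2 * j + a))) := by
  simp only [qp, map_prod, map_sub, map_one, map_pow, RatFunc.algebraMap_X]
  exact prod_congr rfl fun j _ => by ring

lemma prod_one_sub_X_pow_ne_zero {a : ℕ} (ha : a ≠ 0) (k : ℕ) :
    (∏ j ∈ range k, (1 - X ^ (2 * j + a)) : ℚ[X]) ≠ 0 :=
  prod_ne_zero_iff.mpr fun _ _ => Polynomial.one_sub_X_pow_ne_zero (by omega)

lemma qp_X_pow_ne_zero {a : ℕ} (ha : a ≠ 0) (k : ℕ) :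
    qp (RatFunc.X ^ a : RatFunc ℚ) (RatFunc.X ^ 2) k ≠ 0 := by
  rw [qp_X_pow]
  exact RatFunc.algebraMap_ne_zero (prod_one_sub_X_pow_ne_zero ha k)

/-- The truncated series has a closed form for every truncation point. -/
lemma sum_eq_closed_form (N : ℕ) :
    (∑ k ∈ range (N + 1),
      qint (4 * k + 1) * qp ((RatFunc.X : RatFunc ℚ) ^ (-1 : ℤ)) (RatFunc.X ^ 2) k *
        (qp RatFunc.X (RatFunc.X ^ 2) k) ^ 3 /
        (qp (RatFunc.X ^ 4) (RatFunc.X ^ 2) k * (qp (RatFunc.X ^ 2) (RatFunc.X ^ 2) k) ^ 3) *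
          RatFunc.X ^ (2 * k)) =
      (qint (2 * N + 1)) ^ 3 * (qp RatFunc.X (RatFunc.X ^ 2) N) ^ 4 /
        (qp (RatFunc.X ^ 4) (RatFunc.X ^ 2) N * (qp (RatFunc.X ^ 2) (RatFunc.X ^ 2) N) ^ 3) := by
  induction N with
  | zero => simp [qp_zero, qint]
  | succ N ih =>
    rw [sum_range_succ, ih]
    have hX : (RatFunc.X : RatFunc ℚ) ≠ 0 := RatFunc.X_ne_zero
    have h1 : (1 - RatFunc.X : RatFunc ℚ) ≠ 0 := by
      simpa using RatFunc.one_sub_X_pow_ne_zero one_ne_zero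
    have hshift : (RatFunc.X : RatFunc ℚ) ^ (-1 : ℤ) * RatFunc.X ^ 2 = RatFunc.X := by
      rw [zpow_neg_one]; field_simp
    have h4 := qp_X_pow_ne_zero four_ne_zero N
    have h2 := qp_X_pow_ne_zero two_ne_zero N
    have h4' : (1 - RatFunc.X ^ 4 * (RatFunc.X ^ 2) ^ N : RatFunc ℚ) ≠ 0 := by
      rw [← pow_mul, ← pow_add]; exact RatFunc.one_sub_X_pow_ne_zero (by omega)
    have h2' : (1 - RatFunc.X ^ 2 * (RatFunc.X ^ 2) ^ N : RatFunc ℚ) ≠ 0 := by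
      rw [← pow_mul, ← pow_add]; exact RatFunc.one_sub_X_pow_ne_zero (by omega)
    have e (m : ℕ) : qint m = (1 - RatFunc.X ^ m) / (1 - RatFunc.X) :=
      eq_div_of_mul_eq h1 (qint_mul_one_sub m)
    rw [qp_succ_left (RatFunc.X ^ (-1 : ℤ)), hshift, qp_succ RatFunc.X, qp_succ (RatFunc.X ^ 4),
      qp_succ (RatFunc.X ^ 2), e, e, e, zpow_neg_one]
    generalize qp (RatFunc.X ^ 4 : RatFunc ℚ) (RatFunc.X ^ 2) N = A at *
    generalize qp (RatFunc.X ^ 2 : RatFunc ℚ) (RatFunc.X ^ 2) N = B at *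
    generalize qp (RatFunc.X : RatFunc ℚ) (RatFunc.X ^ 2) N = C at *
    have p1 : (RatFunc.X : RatFunc ℚ) ^ (2 * N + 1) = (RatFunc.X ^ 2) ^ N * RatFunc.X := by ring
    have p2 : (RatFunc.X : RatFunc ℚ) ^ (2 * (N + 1) + 1) =
      (RatFunc.X ^ 2) ^ N * RatFunc.X ^ 3 := by ring
    have p3 : (RatFunc.X : RatFunc ℚ) ^ (4 * (N + 1) + 1) =
      ((RatFunc.X ^ 2) ^ N) ^ 2 * RatFunc.X ^ 5 := by ring
    have p4 : (RatFunc.X : RatFunc ℚ) ^ (2 * (N + 1)) =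
      (RatFunc.X ^ 2) ^ N * RatFunc.X ^ 2 := by ring
    rw [p1, p2, p3, p4]
    generalize ((RatFunc.X : RatFunc ℚ) ^ 2) ^ N = x at *
    generalize (RatFunc.X : RatFunc ℚ) = q at *
    generalize hu : 1 - q ^ 4 * x = u at h4' ⊢
    generalize hv : 1 - q ^ 2 * x = v at h2' ⊢
    field_simp
    rw [← hu, ← hv]
    ring

/-- Integrality of the `q`-binomial coefficient. -/
lemma prod_mul_prod_dvd_prod_add (k m : ℕ) :
    (∏ i ∈ range k, (1 - X ^ (i + 1) : ℚ[X])) * ∏ i ∈ range m, (1 - X ^ (i + 1) : ℚ[X]) ∣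
      ∏ i ∈ range (k + m), (1 - X ^ (i + 1) : ℚ[X]) := by
  induction k generalizing m with
  | zero => simp
  | succ k ihk =>
    induction m with
    | zero => simp
    | succ m ihm =>
      have hsplit : (1 - X ^ (k + m + 1 + 1) : ℚ[X]) =
          (1 - X ^ (k + 1)) + X ^ (k + 1) * (1 - X ^ (m + 1)) := by ring
      rw [show k + 1 + (m + 1) = (k + m + 1) + 1 by ring, prod_range_succ _ (k + m + 1), hsplit,
        mul_add]
      refine dvd_add ?_ ?_
      · have := mul_dvd_mul (ihk (m + 1)) (dvd_refl (1 - X ^ (k + 1) : ℚ[X]))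
        rw [prod_range_succ _ k, mul_right_comm]
        exact this
      · have := mul_dvd_mul ihm (dvd_refl (1 - X ^ (m + 1) : ℚ[X]))
        rw [show k + 1 + m = k + m + 1 by ring] at this
        rw [prod_range_succ _ m, ← mul_assoc, mul_left_comm]
        exact this.mul_left _

lemma prod_odd_mul_prod_even (N : ℕ) :
    (∏ j ∈ range N, (1 - X ^ (2 * j + 1) : ℚ[X])) * ∏ j ∈ range N, (1 - X ^ (2 * j + 2)) =
      ∏ i ∈ range (N + N), (1 - X ^ (i + 1)) := by
  rw [← two_mul]
  induction N with
  | zero => simp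
  | succ N ih =>
    rw [show 2 * (N + 1) = 2 * N + 1 + 1 by ring]
    simp only [prod_range_succ, ← ih]
    ring

lemma prod_one_sub_mul_prod_one_add (N : ℕ) :
    (∏ j ∈ range N, (1 - X ^ (j + 1) : ℚ[X])) * ∏ j ∈ range N, (1 + X ^ (j + 1)) =
      ∏ j ∈ range N, (1 - X ^ (2 * j + 2)) := by
  rw [← prod_mul_distrib]
  exact prod_congr rfl fun j _ => by ring

/-- `(q;q²)_N (-q;q)_N² / (q²;q²)_N` is a polynomial, the central `q`-binomial coefficient. -/
lemma exists_prod_odd_mul_eq (N : ℕ) : ∃ g : ℚ[X],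
    (∏ j ∈ range N, (1 - X ^ (2 * j + 1))) * (∏ j ∈ range N, (1 + X ^ (j + 1))) ^ 2 =
      (∏ j ∈ range N, (1 - X ^ (2 * j + 2))) * g := by
  obtain ⟨g, hg⟩ := prod_mul_prod_dvd_prod_add N N
  refine ⟨g, ?_⟩
  rw [← prod_odd_mul_prod_even, ← prod_one_sub_mul_prod_one_add] at hg
  rw [← prod_one_sub_mul_prod_one_add]
  have hF : (∏ j ∈ range N, (1 - X ^ (j + 1)) : ℚ[X]) ≠ 0 :=
    prod_ne_zero_iff.mpr fun _ _ => Polynomial.one_sub_X_pow_ne_zero (by omega)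
  apply mul_left_cancel₀ hF
  linear_combination (∏ j ∈ range N, (1 + X ^ (j + 1))) * hg

lemma prod_four_mul_one_add_X (N : ℕ) :
    (∏ j ∈ range N, (1 - X ^ (2 * j + 4))) * (1 + X) =
      (∏ j ∈ range N, (1 - X ^ (2 * j + 2))) * qnat (2 * N + 2) := by
  have h1 : (1 - X : ℚ[X]) ≠ 0 := by
    simpa using Polynomial.one_sub_X_pow_ne_zero one_ne_zero
  have h : (∏ j ∈ range N, (1 - X ^ (2 * j + 4) : ℚ[X])) * (1 - X ^ 2) =
      (∏ j ∈ range N, (1 - X ^ (2 * j + 2))) * (1 - X ^ (2 * N + 2)) := by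
    rw [← prod_range_succ (fun j => (1 - X ^ (2 * j + 2) : ℚ[X])), prod_range_succ']
    simp [mul_add]
  apply mul_right_cancel₀ h1
  rw [mul_assoc _ (qnat _), qnat_mul_one_sub, ← h]
  ring

lemma isCoprime_qnat_succ (n : ℕ) : IsCoprime (qnat n) (qnat (n + 1)) := by
  have h : qnat (n + 1) = 1 + qnat n * X := by
    simp [qnat, sum_range_succ', sum_mul, pow_succ, add_comm]
  rw [h]
  exact isCoprime_one_right.add_mul_left_right X

lemma isCoprime_qnat_one_add_X_pow {n : ℕ} (hn : Odd n) (j : ℕ) :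
    IsCoprime (qnat n) (1 + X ^ j) := by
  obtain ⟨a, ha⟩ : qnat n ∣ 1 - X ^ (n * j) := by
    refine (Dvd.intro _ (qnat_mul_one_sub n)).trans ?_
    simpa [pow_mul] using sub_dvd_pow_sub_pow (1 : ℚ[X]) (X ^ n) j
  obtain ⟨b, hb⟩ : (1 + X ^ j : ℚ[X]) ∣ 1 + X ^ (n * j) := by
    simpa [← pow_mul, mul_comm] using hn.add_dvd_pow_add_pow (1 : ℚ[X]) (X ^ j)
  have hC : (C (1 / 2) * 2 : ℚ[X]) = 1 := by
    rw [← map_ofNat C, ← C_mul]; norm_num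
  exact ⟨C (1 / 2) * a, C (1 / 2) * b, by
    linear_combination hC - C (1 / 2) * ha - C (1 / 2) * hb⟩

lemma qnat_pow_dvd_num {N : ℕ} {S : RatFunc ℚ}
    (hS : S = (qint (2 * N + 1)) ^ 3 * (qp RatFunc.X (RatFunc.X ^ 2) N) ^ 4 /
        (qp (RatFunc.X ^ 4) (RatFunc.X ^ 2) N * (qp (RatFunc.X ^ 2) (RatFunc.X ^ 2) N) ^ 3)) :
    qnat (2 * N + 1) ^ 3 ∣ S.num := by
  have h4 := prod_one_sub_X_pow_ne_zero four_ne_zero N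
  have h2 := prod_one_sub_X_pow_ne_zero two_ne_zero N
  have hX := qp_X_pow 1 N
  rw [pow_one] at hX
  rw [hX, qp_X_pow, qp_X_pow, ← algebraMap_qnat, ← map_pow, ← map_pow, ← map_pow, ← map_mul,
    ← map_mul] at hS
  obtain ⟨g, hg⟩ := exists_prod_odd_mul_eq N
  have hQ := prod_four_mul_one_add_X N
  set P := ∏ j ∈ range N, (1 - X ^ (2 * j + 1) : ℚ[X])
  set Q := ∏ j ∈ range N, (1 - X ^ (2 * j + 2) : ℚ[X])
  set R := ∏ j ∈ range N, (1 - X ^ (2 * j + 4) : ℚ[X])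
  set M := ∏ j ∈ range N, (1 + X ^ (j + 1) : ℚ[X])
  have hcross : S.num * (R * Q ^ 3) = qnat (2 * N + 1) ^ 3 * P ^ 4 * S.denom := by
    apply RatFunc.algebraMap_injective ℚ
    have hb := RatFunc.algebraMap_ne_zero (mul_ne_zero h4 (pow_ne_zero 3 h2))
    have hd := RatFunc.algebraMap_ne_zero S.denom_ne_zero
    rw [map_mul, map_mul _ _ S.denom, ← div_eq_div_iff hd hb, RatFunc.num_div_denom, ← hS]
  have hcop : IsCoprime (qnat (2 * N + 1)) (qnat (2 * N + 2) * M ^ 8) := by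
    refine (isCoprime_qnat_succ _).mul_right (IsCoprime.pow_right ?_)
    exact IsCoprime.prod_right fun j _ =>
      isCoprime_qnat_one_add_X_pow (odd_two_mul_add_one N) (j + 1)
  refine (hcop.pow_left (m := 3)).dvd_of_dvd_mul_right ⟨g ^ 4 * (1 + X) * S.denom, ?_⟩
  apply mul_left_cancel₀ (pow_ne_zero 4 h2)
  have hg4 : P ^ 4 * M ^ 8 = Q ^ 4 * g ^ 4 := by
    rw [← mul_pow, ← hg]; ring
  linear_combination M ^ 8 * (1 + X) * hcross - S.num * Q ^ 3 * M ^ 8 * hQ +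
    qnat (2 * N + 1) ^ 3 * S.denom * (1 + X) * hg4

/-- closed form at `N = (n-1)/2` and divisibility by `[n]^3`. -/
theorem stmt7 (n : ℕ) (hn : 1 < n) (hodd : Odd n) :
    letI q : RatFunc ℚ := RatFunc.X
    letI S : RatFunc ℚ := ∑ k ∈ Finset.range ((n - 1) / 2 + 1),
      qint (4 * k + 1) * qp (q ^ (-1 : ℤ)) (q ^ 2) k * (qp q (q ^ 2) k) ^ 3 /
        (qp (q ^ 4) (q ^ 2) k * (qp (q ^ 2) (q ^ 2) k) ^ 3) * q ^ (2 * k)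
    (S = (qint n) ^ 3 * (qp q (q ^ 2) ((n - 1) / 2)) ^ 4 /
        (qp (q ^ 4) (q ^ 2) ((n - 1) / 2) * (qp (q ^ 2) (q ^ 2) ((n - 1) / 2)) ^ 3)) ∧
    (qnat n) ^ 3 ∣ S.num := by
  obtain ⟨N, rfl⟩ := hodd
  rw [show (2 * N + 1 - 1) / 2 = N by omega]
  exact ⟨sum_eq_closed_form N, qnat_pow_dvd_num (sum_eq_closed_form N)⟩
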